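/- Let n ∈ ℕ, P = {0, 1, …, n}, P⁺ = P ∪ {∞}, fix positive integer weights a, b, let ε ∈ ℕ, and let Λ_ε be the maximal translation of height ε. Let K be a field and let I = ⊕_{s∈S} I_s and M = ⊕_{t∈T} M_t be finite direct sums of convex representations of P. If there exists a (Λ_ε, Λ_ε)-interleaving between I and M, then there exists an ε-matching between I and M. -/

import Mathlib

namespace GPM

/-- A translation on a preorder: a monotone map `Λ` with `x ≤ Λ x` for all `x`. -/
structure Translation (Q : Type*) [Preorder Q] where
  toFun : Q → Q
  mono : Monotone toFun
  le_apply : ∀ x, x ≤ toFun x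

/-- A representation of a poset `P` with values in `K`-vector spaces. -/
structure Rep (P : Type*) [Preorder P] (K : Type*) [Field K] where
  V : P → Type*
  [addCommGroup : ∀ p, AddCommGroup (V p)]
  [module : ∀ p, Module K (V p)]
  map : ∀ {p q : P}, p ≤ q → V p →ₗ[K] V q
  map_refl : ∀ p : P, map (le_refl p) = LinearMap.id
  map_comp : ∀ {p q r : P} (hpq : p ≤ q) (hqr : q ≤ r),
      (map hqr).comp (map hpq) = map (hpq.trans hqr)

attribute [instance] Rep.addCommGroup Rep.module

/-- A morphism of representations (a natural transformation). -/
structure RepHom {P : Type*} [Preorder P] {K : Type*} [Field K] (M N : Rep P K) where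
  app : ∀ p, M.V p →ₗ[K] N.V p
  natural : ∀ {p q : P} (h : p ≤ q), (N.map h).comp (app p) = (app q).comp (M.map h)

/-- The shift `MΛ : p ↦ M(Λ p)` of a representation by a translation. -/
def Rep.shift {P : Type*} [Preorder P] {K : Type*} [Field K]
    (M : Rep P K) (Λ : Translation P) : Rep P K where
  V p := M.V (Λ.toFun p)
  map h := M.map (Λ.mono h)
  map_refl p := M.map_refl (Λ.toFun p)
  map_comp h1 h2 := M.map_comp (Λ.mono h1) (Λ.mono h2)

/-- `(φ, ψ)` is a `(Λ, Γ)`-interleaving between `F` and `G`: `φ : F → GΛ`, `ψ : G → FΓ`,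
`ψΛ ∘ φ` is the canonical morphism `F → FΓΛ` and `φΓ ∘ ψ` is the canonical morphism
`G → GΛΓ`. -/
def IsInterleaving {P : Type*} [Preorder P] {K : Type*} [Field K]
    (Λ Γ : Translation P) (F G : Rep P K)
    (φ : RepHom F (G.shift Λ)) (ψ : RepHom G (F.shift Γ)) : Prop :=
  (∀ p, (ψ.app (Λ.toFun p)).comp (φ.app p)
      = F.map ((Λ.le_apply p).trans (Γ.le_apply (Λ.toFun p)))) ∧
  (∀ p, (φ.app (Γ.toFun p)).comp (ψ.app p)
      = G.map ((Γ.le_apply p).trans (Λ.le_apply (Γ.toFun p))))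

/-- `F` and `G` are `(Λ, Γ)`-interleaved. -/
def Interleaved {P : Type*} [Preorder P] {K : Type*} [Field K]
    (Λ Γ : Translation P) (F G : Rep P K) : Prop :=
  ∃ φ ψ, IsInterleaving Λ Γ F G φ ψ

/-- The submodule of `K` underlying the convex representation of `S` at the point `p`:
all of `K` on `S`, and `0` off `S`. -/
noncomputable def convexSub (K : Type*) [Field K] {Q : Type*} (S : Set Q) (p : Q) :
    Submodule K K :=
  @ite _ (p ∈ S) (Classical.dec _) ⊤ ⊥

theorem convexSub_pos (K : Type*) [Field K] {Q : Type*} {S : Set Q} {p : Q} (h : p ∈ S) :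
    convexSub K S p = ⊤ := by
  rw [convexSub, if_pos h]

theorem convexSub_neg (K : Type*) [Field K] {Q : Type*} {S : Set Q} {p : Q} (h : p ∉ S) :
    convexSub K S p = ⊥ := by
  rw [convexSub, if_neg h]

/-- The canonical map between the fibers of the convex representations of `S` and `T`:
the identity of `K` when both fibers are `K`, and zero otherwise. -/
noncomputable def phiMap (K : Type*) [Field K] {Q : Type*} (S T : Set Q) (p q : Q) :
    ↥(convexSub K S p) →ₗ[K] ↥(convexSub K T q) :=
  @dite _ (p ∈ S ∧ q ∈ T) (Classical.dec _)
    (fun h => Submodule.inclusion (le_of_eq (by rw [convexSub_pos K h.1, convexSub_pos K h.2])))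
    (fun _ => 0)

theorem phiMap_neg (K : Type*) [Field K] {Q : Type*} {S T : Set Q} {p q : Q}
    (h : ¬(p ∈ S ∧ q ∈ T)) : phiMap K S T p q = 0 := by
  rw [phiMap, dif_neg h]

/-- The convex representation with support the interval-convex set `S`:
`K` at points of `S`, `0` elsewhere, with identity structure maps inside `S`. -/
noncomputable def convexRep (K : Type*) [Field K] {Q : Type*} [Preorder Q]
    (S : Set Q) (hS : S.OrdConnected) : Rep Q K where
  V p := ↥(convexSub K S p)
  map {p q} _ := phiMap K S S p q
  map_refl p := by
    show phiMap K S S p p = LinearMap.id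
    by_cases hp : p ∈ S
    · rw [phiMap, dif_pos ⟨hp, hp⟩]
      rfl
    · rw [phiMap_neg (K := K) (by tauto)]
      apply LinearMap.ext
      intro x
      have hx : x = 0 := by
        apply Subtype.ext
        have hle : convexSub K S p ≤ ⊥ := le_of_eq (convexSub_neg K hp)
        simpa using hle x.2
      simp [hx]
  map_comp {p q r} hpq hqr := by
    show (phiMap K S S q r).comp (phiMap K S S p q) = phiMap K S S p r
    by_cases hp : p ∈ S
    · by_cases hr : r ∈ S
      · have hq : q ∈ S := hS.out hp hr ⟨hpq, hqr⟩
        rw [phiMap, phiMap, phiMap, dif_pos ⟨hq, hr⟩, dif_pos ⟨hp, hq⟩, dif_pos ⟨hp, hr⟩]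
        rfl
      · rw [phiMap_neg (K := K) (S := S) (T := S) (p := q) (q := r) (by tauto),
          phiMap_neg (K := K) (S := S) (T := S) (p := p) (q := r) (by tauto)]
        simp
    · rw [phiMap_neg (K := K) (S := S) (T := S) (p := p) (q := q) (by tauto),
        phiMap_neg (K := K) (S := S) (T := S) (p := p) (q := r) (by tauto)]
      simp

/-- Direct sum of a (finite) family of representations. -/
def Rep.dfsum {P : Type*} [Preorder P] {K : Type*} [Field K]
    {ι : Type*} (X : ι → Rep P K) : Rep P K where
  V p := ∀ i, (X i).V p
  map h := LinearMap.pi fun i => ((X i).map h).comp (LinearMap.proj i)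
  map_refl p := by
    apply LinearMap.ext
    intro x
    funext i
    simp [(X i).map_refl]
  map_comp h1 h2 := by
    apply LinearMap.ext
    intro x
    funext i
    have := congrArg (fun f => f (x i)) ((X i).map_comp h1 h2)
    simp only [LinearMap.comp_apply] at this
    simpa using this

/-- The maximal translation `Λ_ε` of height `ε` on `P⁺ = {0, …, n} ∪ {∞}`,
for the weights `(a, b)`:  `Λ_ε ∞ = ∞`, and for `x ∈ P`, `Λ_ε x = ∞` if
`a(n−x)+b ≤ ε` and `Λ_ε x = min n (x + ⌊ε/a⌋)` otherwise. -/
def lamFun (n a b ε : ℕ) : WithTop (Fin (n + 1)) → WithTop (Fin (n + 1)) :=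
  WithTop.recTopCoe ⊤ fun x =>
    if a * (n - (x : ℕ)) + b ≤ ε then ⊤
    else (↑(⟨min n ((x : ℕ) + ε / a), by omega⟩ : Fin (n + 1)) : WithTop (Fin (n + 1)))

theorem lamFun_coe (n a b ε : ℕ) (x : Fin (n + 1)) :
    lamFun n a b ε (↑x) =
      if a * (n - (x : ℕ)) + b ≤ ε then ⊤
      else (↑(⟨min n ((x : ℕ) + ε / a), by omega⟩ : Fin (n + 1)) : WithTop (Fin (n + 1))) := rfl

theorem lamFun_le (n a b ε : ℕ) : ∀ x, x ≤ lamFun n a b ε x := by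
  intro x
  induction x using WithTop.recTopCoe with
  | top => exact le_refl _
  | coe x =>
      rw [lamFun_coe]
      by_cases h : a * (n - (x : ℕ)) + b ≤ ε
      · rw [if_pos h]
        exact le_top
      · rw [if_neg h]
        apply WithTop.coe_le_coe.mpr
        rw [Fin.le_def]
        have hx : (x : ℕ) < n + 1 := x.2
        exact le_min (Nat.le_of_lt_succ hx) (Nat.le_add_right _ _)

theorem lamFun_mono (n a b ε : ℕ) : Monotone (lamFun n a b ε) := by
  intro x y hxy
  induction x using WithTop.recTopCoe with
  | top =>
      have : y = ⊤ := top_le_iff.mp hxy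
      subst this
      exact le_refl _
  | coe x =>
      induction y using WithTop.recTopCoe with
      | top => exact le_top
      | coe y =>
          have hxy' : (x : ℕ) ≤ (y : ℕ) := by exact_mod_cast WithTop.coe_le_coe.mp hxy
          rw [lamFun_coe, lamFun_coe]
          by_cases h2 : a * (n - (y : ℕ)) + b ≤ ε
          · rw [if_pos h2]
            exact le_top
          · have h1 : ¬ a * (n - (x : ℕ)) + b ≤ ε := by
              intro h1
              apply h2
              calc a * (n - (y : ℕ)) + b ≤ a * (n - (x : ℕ)) + b := by
                    gcongr
                _ ≤ ε := h1
            rw [if_neg h1, if_neg h2]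
            apply WithTop.coe_le_coe.mpr
            rw [Fin.le_def]
            exact min_le_min (le_refl n) (Nat.add_le_add_right hxy' _)

/-- The maximal translation of height `ε` packaged as a `Translation`. -/
def lamTrans (n a b ε : ℕ) : Translation (WithTop (Fin (n + 1))) :=
  ⟨lamFun n a b ε, lamFun_mono n a b ε, lamFun_le n a b ε⟩

/-- The convex representation of `{0, …, n}` with support the interval `[x, X]`,
regarded as a representation of `P⁺` which is zero at `∞`. -/
noncomputable def intervalRep (n : ℕ) (K : Type*) [Field K] (x X : Fin (n + 1)) :
    Rep (WithTop (Fin (n + 1))) K :=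
  convexRep K (Set.Icc (↑x) (↑X)) Set.ordConnected_Icc

/-- The width of the convex representation with support `[x, X] ⊆ {0, …, n}`:
the least `ε` with `Λ_ε(Λ_ε x) > X` in `P⁺`. -/
noncomputable def width (n a b : ℕ) (x X : Fin (n + 1)) : ℕ :=
  sInf {ε : ℕ | (↑X : WithTop (Fin (n + 1))) < lamFun n a b ε (lamFun n a b ε ↑x)}

/-- An `ε`-matching between the direct sums of the convex representations with supports
`[lo s, hi s]` (`s ∈ ι`) and `[lo' t, hi' t]` (`t ∈ κ`): a bijection between subsets
`S' ⊆ ι` and `T' ⊆ κ` containing all indices of width `> ε`, matched summands being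
`(Λ_ε, Λ_ε)`-interleaved. -/
def IsMatching (n a b ε : ℕ) (K : Type*) [Field K] {ι κ : Type*}
    (lo hi : ι → Fin (n + 1)) (lo' hi' : κ → Fin (n + 1)) : Prop :=
  ∃ (S' : Set ι) (T' : Set κ) (f : S' → T'),
    Function.Bijective f ∧
    (∀ s : ι, ε < width n a b (lo s) (hi s) → s ∈ S') ∧
    (∀ t : κ, ε < width n a b (lo' t) (hi' t) → t ∈ T') ∧
    (∀ s : S', Interleaved (lamTrans n a b ε) (lamTrans n a b ε)
        (intervalRep n K (lo s.1) (hi s.1)) (intervalRep n K (lo' (f s).1) (hi' (f s).1)))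

/-! ### Homomorphisms between convex representations -/

theorem phiMap_pos_apply (K : Type*) [Field K] {Q : Type*} {S T : Set Q} {p q : Q}
    (hp : p ∈ S) (hq : q ∈ T) (v : convexSub K S p) :
    (phiMap K S T p q v : K) = v := by
  rw [phiMap, dif_pos ⟨hp, hq⟩]
  rfl

theorem convexSub_val_eq_zero (K : Type*) [Field K] {Q : Type*} {S : Set Q} {p : Q}
    (hp : p ∉ S) (v : convexSub K S p) : (v : K) = 0 :=
  (Submodule.mem_bot K).1 ((convexSub_neg K hp).le v.2)

theorem phiMap_comp (K : Type*) [Field K] {Q : Type*} {S T U : Set Q} {p q r : Q}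
    (h : p ∈ S → r ∈ U → q ∈ T) :
    (phiMap K T U q r).comp (phiMap K S T p q) = phiMap K S U p r := by
  ext v
  by_cases hp : p ∈ S
  · by_cases hr : r ∈ U
    · have hq := h hp hr
      rw [LinearMap.comp_apply, phiMap_pos_apply K hq hr, phiMap_pos_apply K hp hq,
        phiMap_pos_apply K hp hr]
    · rw [convexSub_val_eq_zero K hr, convexSub_val_eq_zero K hr]
  · rw [phiMap_neg K (S := S) (T := T) fun h => hp h.1,
      phiMap_neg K (S := S) (T := U) fun h => hp h.1]
    simp

theorem Interleaved.symm {P : Type*} [Preorder P] {K : Type*} [Field K]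
    {Λ Γ : Translation P} {F G : Rep P K} (h : Interleaved Λ Γ F G) :
    Interleaved Γ Λ G F := by
  obtain ⟨φ, ψ, h₁, h₂⟩ := h
  exact ⟨ψ, φ, h₂, h₁⟩

/-- There is room for a nonzero morphism from the convex representation of `[x, X]` to the
`Λ`-shift of that of `[y, Y]`. -/
def ShiftLE {Q : Type*} [Preorder Q] (Λ : Translation Q) (x X y Y : Q) : Prop :=
  y ≤ Λ.toFun x ∧ ∀ p, Λ.toFun p ≤ Y → p ≤ X

/-- The canonical morphism from the convex representation of `[x, X]` to the `Λ`-shift of that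
of `[y, Y]`. -/
noncomputable def ShiftLE.hom {Q : Type*} [Preorder Q] {Λ : Translation Q} {x X y Y : Q}
    (K : Type*) [Field K] (h : ShiftLE Λ x X y Y) :
    RepHom (convexRep K (Set.Icc x X) Set.ordConnected_Icc)
      ((convexRep K (Set.Icc y Y) Set.ordConnected_Icc).shift Λ) where
  app p := phiMap K (Set.Icc x X) (Set.Icc y Y) p (Λ.toFun p)
  natural {p q} hpq := by
    refine (phiMap_comp K fun hp hq => ?_).trans (phiMap_comp K fun hp hq => ?_).symm
    · exact ⟨h.1.trans (Λ.mono hp.1), (Λ.mono hpq).trans hq.2⟩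
    · exact ⟨hp.1.trans hpq, h.2 q hq.2⟩

theorem interleaved_of_shiftLE {Q : Type*} [Preorder Q] {Λ : Translation Q} {x X y Y : Q}
    (K : Type*) [Field K] (h : ShiftLE Λ x X y Y) (h' : ShiftLE Λ y Y x X) :
    Interleaved Λ Λ (convexRep K (Set.Icc x X) Set.ordConnected_Icc)
      (convexRep K (Set.Icc y Y) Set.ordConnected_Icc) := by
  refine ⟨h.hom K, h'.hom K, fun p => ?_, fun p => ?_⟩
  · exact phiMap_comp K fun hp hq => ⟨h.1.trans (Λ.mono hp.1), h'.2 _ hq.2⟩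
  · exact phiMap_comp K fun hp hq => ⟨h'.1.trans (Λ.mono hp.1), h.2 _ hq.2⟩

/-! ### Matrix entries of morphisms between sums of convex representations -/

section Entries

variable {Q : Type*} [PartialOrder Q] {K : Type*} [Field K] {Λ : Translation Q}
  {ι κ : Type*} {x X : ι → Q} {y Y : κ → Q}

/-- The direct sum of the convex representations of the intervals `[x i, X i]`. -/
noncomputable abbrev intervalSum (K : Type*) [Field K] (x X : ι → Q) : Rep Q K :=
  Rep.dfsum fun i => convexRep K (Set.Icc (x i) (X i)) Set.ordConnected_Icc

/-- The coordinate with index `i` of the fiber at `p`. -/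
noncomputable def coord (K : Type*) [Field K] (x X : ι → Q) (i : ι) (p : Q) :
    (intervalSum K x X).V p →ₗ[K] K :=
  (convexSub K (Set.Icc (x i) (X i)) p).subtype.comp
    (LinearMap.proj (φ := fun i => ↥(convexSub K (Set.Icc (x i) (X i)) p)) i)

theorem coord_ext {p : Q} {v w : (intervalSum K x X).V p}
    (h : ∀ i, coord K x X i p v = coord K x X i p w) : v = w :=
  funext fun i => Subtype.ext (h i)

theorem coord_of_notMem {i : ι} {p : Q} (hp : p ∉ Set.Icc (x i) (X i))
    (v : (intervalSum K x X).V p) : coord K x X i p v = 0 :=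
  convexSub_val_eq_zero K hp _

theorem coord_map {i : ι} {p q : Q} (hpq : p ≤ q) (hq : q ∈ Set.Icc (x i) (X i))
    (v : (intervalSum K x X).V p) :
    coord K x X i q ((intervalSum K x X).map hpq v) = coord K x X i p v := by
  by_cases hp : p ∈ Set.Icc (x i) (X i)
  · exact phiMap_pos_apply K hp hq _
  · rw [coord_of_notMem hp]
    change ((phiMap K (Set.Icc (x i) (X i)) (Set.Icc (x i) (X i)) p q) _ : K) = 0
    rw [phiMap_neg K fun h => hp h.1]
    rfl

open Classical in
/-- The unit of the fiber at `p` of the summand with index `i`. -/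
noncomputable def unitVec (K : Type*) [Field K] (x X : ι → Q) (i : ι) (p : Q) :
    (intervalSum K x X).V p :=
  fun j => (⟨if j = i ∧ p ∈ Set.Icc (x j) (X j) then 1 else 0, by
    split_ifs with h
    · exact (convexSub_pos K h.2).ge trivial
    · exact zero_mem _⟩ : convexSub K (Set.Icc (x j) (X j)) p)

open Classical in
theorem coord_unitVec (i j : ι) (p : Q) :
    coord K x X j p (unitVec K x X i p)
      = if j = i ∧ p ∈ Set.Icc (x j) (X j) then 1 else 0 := rfl

theorem map_unitVec {i : ι} {p q : Q} (hpq : p ≤ q) (hp : p ∈ Set.Icc (x i) (X i)) :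
    (intervalSum K x X).map hpq (unitVec K x X i p) = unitVec K x X i q := by
  refine coord_ext fun j => ?_
  by_cases hq : q ∈ Set.Icc (x j) (X j)
  · rw [coord_map hpq hq, coord_unitVec, coord_unitVec]
    by_cases h : j = i
    · subst h
      rw [if_pos ⟨rfl, hp⟩, if_pos ⟨rfl, hq⟩]
    · rw [if_neg fun h' => h h'.1, if_neg fun h' => h h'.1]
  · rw [coord_of_notMem hq, coord_of_notMem hq]

theorem unitVec_of_notMem {i : ι} {p : Q} (hp : p ∉ Set.Icc (x i) (X i)) :
    unitVec K x X i p = 0 := by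
  refine coord_ext fun j => ?_
  rw [coord_unitVec, map_zero]
  refine if_neg ?_
  rintro ⟨rfl, h⟩
  exact hp h

theorem eq_sum_unitVec [Fintype ι] {p : Q} (v : (intervalSum K x X).V p) :
    v = ∑ i, coord K x X i p v • unitVec K x X i p := by
  refine coord_ext fun j => ?_
  rw [map_sum]
  simp_rw [map_smul, coord_unitVec]
  by_cases hp : p ∈ Set.Icc (x j) (X j)
  · rw [Finset.sum_eq_single j, if_pos ⟨rfl, hp⟩, smul_eq_mul, mul_one]
    · intro i _ hij
      rw [if_neg fun h => hij h.1.symm, smul_zero]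
    · simp
  · rw [coord_of_notMem hp, Finset.sum_eq_zero]
    intro i _
    rw [if_neg fun h => hp h.2, smul_zero]

/-- The matrix entry at `p` of a morphism between sums of convex representations. -/
noncomputable def entryAt (φ : RepHom (intervalSum K x X) ((intervalSum K y Y).shift Λ))
    (i : ι) (j : κ) (p : Q) : K :=
  coord K y Y j (Λ.toFun p) (φ.app p (unitVec K x X i p))

theorem entryAt_eq_zero_of_notMem_right
    (φ : RepHom (intervalSum K x X) ((intervalSum K y Y).shift Λ))
    {i : ι} {j : κ} {p : Q} (hp : Λ.toFun p ∉ Set.Icc (y j) (Y j)) : entryAt φ i j p = 0 :=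
  coord_of_notMem hp _

theorem entryAt_eq_zero_of_notMem_left
    (φ : RepHom (intervalSum K x X) ((intervalSum K y Y).shift Λ))
    {i : ι} {j : κ} {p : Q} (hp : p ∉ Set.Icc (x i) (X i)) : entryAt φ i j p = 0 := by
  rw [entryAt, unitVec_of_notMem hp, map_zero]
  exact map_zero _

theorem entryAt_eq_of_le (φ : RepHom (intervalSum K x X) ((intervalSum K y Y).shift Λ))
    {i : ι} {j : κ} {p q : Q} (hpq : p ≤ q) (hp : p ∈ Set.Icc (x i) (X i))
    (hq : Λ.toFun q ∈ Set.Icc (y j) (Y j)) : entryAt φ i j p = entryAt φ i j q := by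
  have h := LinearMap.congr_fun (φ.natural hpq) (unitVec K x X i p)
  rw [LinearMap.comp_apply, LinearMap.comp_apply, map_unitVec hpq hp] at h
  rw [entryAt, entryAt, ← h]
  exact (coord_map (Λ.mono hpq) hq _).symm

/-- The matrix entry of a morphism between sums of convex representations. -/
noncomputable def entry (φ : RepHom (intervalSum K x X) ((intervalSum K y Y).shift Λ))
    (i : ι) (j : κ) : K :=
  entryAt φ i j (x i)

theorem shiftLE_of_entry_ne_zero {Q : Type*} [LinearOrder Q] {Λ : Translation Q}
    {x X : ι → Q} {y Y : κ → Q}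
    (φ : RepHom (intervalSum K x X) ((intervalSum K y Y).shift Λ))
    {i : ι} {j : κ} (h : entry φ i j ≠ 0) : ShiftLE Λ (x i) (X i) (y j) (Y j) := by
  have hl : x i ∈ Set.Icc (x i) (X i) := by
    by_contra hl
    exact h (entryAt_eq_zero_of_notMem_left φ hl)
  have hr : Λ.toFun (x i) ∈ Set.Icc (y j) (Y j) := by
    by_contra hr
    exact h (entryAt_eq_zero_of_notMem_right φ hr)
  refine ⟨hr.1, fun p hp => ?_⟩
  by_contra! hX
  have hxp : x i ≤ p := hl.2.trans hX.le
  apply h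
  rw [entry, entryAt_eq_of_le φ hxp hl ⟨hr.1.trans (Λ.mono hxp), hp⟩]
  exact entryAt_eq_zero_of_notMem_left φ fun hp => hX.not_ge hp.2

open Classical in
/-- Multiplication of matrix entries for the first half of an interleaving. -/
theorem sum_entry_mul_entry {Q : Type*} [LinearOrder Q] {Λ : Translation Q}
    {x X : ι → Q} {y Y : κ → Q} [Fintype κ]
    {φ : RepHom (intervalSum K x X) ((intervalSum K y Y).shift Λ)}
    {ψ : RepHom (intervalSum K y Y) ((intervalSum K x X).shift Λ)}
    (h : IsInterleaving Λ Λ _ _ φ ψ) (hy : ∀ j, y j ≤ Y j) {i i' : ι} (hi : x i ≤ X i)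
    (hi' : Λ.toFun (Λ.toFun (x i)) ∈ Set.Icc (x i') (X i')) :
    ∑ j, entry φ i j * entry ψ j i' = if i' = i then 1 else 0 := by
  have h₁ := LinearMap.congr_fun (h.1 (x i)) (unitVec K x X i (x i))
  have h₂ := map_unitVec (K := K) (X := X) ((Λ.le_apply (x i)).trans (Λ.le_apply _))
    ⟨le_rfl, hi⟩
  have hsum : φ.app (x i) (unitVec K x X i (x i))
      = ∑ j, entry φ i j • unitVec K y Y j (Λ.toFun (x i)) :=
    eq_sum_unitVec (K := K) (x := y) (X := Y) (p := Λ.toFun (x i)) _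
  have h₃ : ψ.app (Λ.toFun (x i)) (∑ j, entry φ i j • unitVec K y Y j (Λ.toFun (x i)))
      = unitVec K x X i (Λ.toFun (Λ.toFun (x i))) :=
    (congrArg (ψ.app (Λ.toFun (x i))) hsum.symm).trans (h₁.trans h₂)
  have h₄ := congrArg (coord K x X i' (Λ.toFun (Λ.toFun (x i)))) h₃
  rw [coord_unitVec, map_sum] at h₄
  simp only [hi', and_true] at h₄
  rw [← h₄]
  refine Eq.trans ?_ (map_sum (coord K x X i' (Λ.toFun (Λ.toFun (x i)))) _ _).symm
  refine Finset.sum_congr rfl fun j _ => ?_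
  rw [map_smul]
  refine Eq.trans ?_ (map_smul (coord K x X i' (Λ.toFun (Λ.toFun (x i)))) _ _).symm
  change _ = entry φ i j * entryAt ψ j i' (Λ.toFun (x i))
  by_cases hj : entry φ i j = 0
  · rw [hj, zero_mul, zero_mul]
  · exact congrArg _
      (entryAt_eq_of_le ψ (shiftLE_of_entry_ne_zero φ hj).1 ⟨le_rfl, hy j⟩ hi')

end Entries

/-! ### Weights -/

/-- The position of the right end of an interval: the cost coordinate of its upper neighbour
in `P⁺`. -/
def endWeight (n a b : ℕ) (X : Fin (n + 1)) : ℕ :=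
  if (X : ℕ) = n then a * n + b else a * (X + 1)

theorem endWeight_mono (n a b : ℕ) : Monotone (endWeight n a b) := by
  intro X Y h
  have hXY : (X : ℕ) ≤ Y := h
  have hY := Y.2
  unfold endWeight
  split_ifs with h₁ h₂
  · exact le_rfl
  · omega
  · exact (Nat.mul_le_mul_left a (by omega)).trans (Nat.le_add_right _ _)
  · exact Nat.mul_le_mul_left a (by omega)

theorem lamFun_eq_top_iff (n a b ε : ℕ) (x : Fin (n + 1)) :
    lamFun n a b ε x = ⊤ ↔ a * n + b ≤ a * x + ε := by
  have hx : a * (n - (x : ℕ)) + a * x = a * n := by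
    rw [← mul_add, Nat.sub_add_cancel (by omega)]
  rw [lamFun_coe]
  split_ifs with h
  · simp only [true_iff]
    omega
  · simp only [WithTop.coe_ne_top, false_iff]
    omega

theorem coe_le_lamFun_iff {n a b ε : ℕ} (ha : 0 < a) (x y : Fin (n + 1)) :
    (y : WithTop (Fin (n + 1))) ≤ lamFun n a b ε x ↔ a * y ≤ a * x + ε := by
  have hx : a * (n - (x : ℕ)) + a * x = a * n := by
    rw [← mul_add, Nat.sub_add_cancel (by omega)]
  have hy : a * (y : ℕ) ≤ a * n := Nat.mul_le_mul_left a (by omega)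
  rw [lamFun_coe]
  split_ifs with h
  · simp only [le_top, true_iff]
    omega
  · rw [WithTop.coe_le_coe, Fin.le_def, le_min_iff, ← Nat.sub_le_iff_le_add',
      Nat.le_div_iff_mul_le ha, Nat.sub_mul, mul_comm _ a, mul_comm _ a]
    omega

theorem forall_lamFun_le_imp_le_iff {n a b ε : ℕ} (ha : 0 < a) (X Y : Fin (n + 1)) :
    (∀ p, lamFun n a b ε p ≤ Y → p ≤ (X : WithTop (Fin (n + 1)))) ↔
      endWeight n a b Y ≤ endWeight n a b X + ε := by
  by_cases hX : (X : ℕ) = n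
  · have hYX : Y ≤ X := Fin.le_def.2 (by omega)
    refine iff_of_true (fun p hp => ?_) ((endWeight_mono n a b hYX).trans (Nat.le_add_right _ _))
    exact ((lamFun_le n a b ε p).trans hp).trans (WithTop.coe_le_coe.2 hYX)
  · let X' : Fin (n + 1) := ⟨X + 1, by omega⟩
    have hsucc : (∀ p, lamFun n a b ε p ≤ Y → p ≤ (X : WithTop (Fin (n + 1)))) ↔
        (Y : WithTop (Fin (n + 1))) < lamFun n a b ε X' := by
      constructor
      · intro h
        by_contra! hY
        have := WithTop.coe_le_coe.1 (h _ hY)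
        rw [Fin.le_def] at this
        simp only [X'] at this
        omega
      · intro h p hp
        by_contra! hXp
        refine (h.trans_le (lamFun_mono n a b ε ?_)).not_ge hp
        induction p using WithTop.recTopCoe with
        | top => exact le_top
        | coe p =>
          rw [WithTop.coe_lt_coe, Fin.lt_def] at hXp
          exact WithTop.coe_le_coe.2 (Fin.le_def.2 hXp)
    rw [hsucc, endWeight, endWeight, if_neg hX]
    split_ifs with hY
    · rw [← lamFun_eq_top_iff n a b ε X']
      constructor
      · intro h
        by_contra htop
        obtain ⟨z, hz⟩ := WithTop.ne_top_iff_exists.1 htop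
        rw [← hz, WithTop.coe_lt_coe, Fin.lt_def] at h
        omega
      · intro h
        rw [h]
        exact WithTop.coe_lt_top Y
    · let Y' : Fin (n + 1) := ⟨Y + 1, by omega⟩
      rw [← coe_le_lamFun_iff (b := b) ha X' Y']
      induction lamFun n a b ε X' using WithTop.recTopCoe with
      | top => simp
      | coe z => rw [WithTop.coe_lt_coe, WithTop.coe_le_coe, Fin.lt_def, Fin.le_def]; rfl

theorem shiftLE_lamTrans_iff {n a b ε : ℕ} (ha : 0 < a) (x X y Y : Fin (n + 1)) :
    ShiftLE (lamTrans n a b ε) (x : WithTop (Fin (n + 1))) X y Y ↔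
      a * y ≤ a * x + ε ∧ endWeight n a b Y ≤ endWeight n a b X + ε :=
  and_congr (coe_le_lamFun_iff ha x y) (forall_lamFun_le_imp_le_iff ha X Y)

theorem lamFun_lamFun_le_of_lt_width {n a b ε : ℕ} {x X : Fin (n + 1)}
    (h : ε < width n a b x X) : lamFun n a b ε (lamFun n a b ε x) ≤ X := by
  by_contra! hX
  exact h.not_ge (Nat.sInf_le hX)

/-! ### Matchings -/

/-- A rank estimate: a product of matrices which is unitriangular for a weight `α` on its index
set factors only through index sets that are at least as large. -/
theorem card_le_card_of_sum_mul_eq {ι κ K : Type*} [Field K] (A : Finset ι) (N : Finset κ)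
    (f : ι → κ → K) (g : κ → ι → K) (α : ι → ℕ)
    (h₁ : ∀ i ∈ A, ∑ j ∈ N, f i j * g j i = 1)
    (h₀ : ∀ i ∈ A, ∀ i' ∈ A, i ≠ i' → α i ≤ α i' → ∑ j ∈ N, f i j * g j i' = 0) :
    A.card ≤ N.card := by
  classical
  let L : (A → K) →ₗ[K] (N → K) := LinearMap.pi fun j =>
    ∑ i : A, f i j • (LinearMap.proj i : (A → K) →ₗ[K] K)
  have hL : ∀ v j, L v j = ∑ i : A, f i j * v i := by
    intro v j
    simp [L, LinearMap.sum_apply]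
  have hinj : Function.Injective L := by
    rw [← LinearMap.ker_eq_bot, LinearMap.ker_eq_bot']
    intro v hv
    by_contra hne
    obtain ⟨i₀, hi₀⟩ := Function.ne_iff.1 hne
    obtain ⟨m, hm, hmax⟩ := Finset.exists_max_image
      (Finset.univ.filter fun i : A => v i ≠ 0) (fun i => α i) ⟨i₀, by simpa using hi₀⟩
    simp only [Finset.mem_filter, Finset.mem_univ, true_and] at hm hmax
    have hzero : ∑ i : A, (∑ j ∈ N, f i j * g j m) * v i = 0 := by
      have hj : ∀ j ∈ N, g j m * ∑ i : A, f i j * v i = 0 := by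
        intro j hj
        rw [← hL v ⟨j, hj⟩, hv, Pi.zero_apply, mul_zero]
      rw [← Finset.sum_eq_zero hj]
      simp_rw [Finset.sum_mul, Finset.mul_sum]
      rw [Finset.sum_comm]
      exact Finset.sum_congr rfl fun j _ => Finset.sum_congr rfl fun i _ => by ring
    rw [Finset.sum_eq_single m, h₁ m m.2, one_mul] at hzero
    · exact hm hzero
    · intro i _ him
      by_cases hvi : v i = 0
      · rw [hvi, mul_zero]
      · rw [h₀ i i.2 m m.2 (fun h => him (Subtype.ext h)) (hmax i hvi), zero_mul]
    · simp
  simpa using LinearMap.finrank_le_finrank_of_injective hinj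

/-- Two partial injections in opposite directions along a relation can be merged into a partial
bijection along this relation that covers both domains (Mendelsohn–Dulmage). -/
theorem exists_bijective_of_injective {ι κ : Type*} (R : ι → κ → Prop) (A : Set ι) (B : Set κ)
    (f : A → κ) (hf : Function.Injective f) (hfR : ∀ s : A, R s (f s))
    (g : B → ι) (hg : Function.Injective g) (hgR : ∀ t : B, R (g t) t) :
    ∃ (S : Set ι) (T : Set κ) (e : S → T), Function.Bijective e ∧ A ⊆ S ∧ B ⊆ T ∧
      ∀ s : S, R s (e s) := by
  classical
  let F : Set A →o Set A :=
    ⟨fun C => {s | ∀ t : B, (t : κ) ∉ f '' C → g t ≠ s}, fun C D hCD s hs t ht =>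
      hs t fun h => ht (Set.image_mono hCD h)⟩
  let C : Set A := F.lfp
  have hC : ∀ s, s ∈ C ↔ ∀ t : B, (t : κ) ∉ f '' C → g t ≠ s := fun s => by
    have h : F C = C := F.map_lfp
    conv_lhs => rw [← h]
    rfl
  let E : ι → κ → Prop := fun s t =>
    (∃ c : A, c ∈ C ∧ s = c ∧ t = f c) ∨ ∃ d : B, (d : κ) ∉ f '' C ∧ s = g d ∧ t = d
  have hER : ∀ s t, E s t → R s t := by
    rintro s t (⟨c, -, rfl, rfl⟩ | ⟨d, -, rfl, rfl⟩)
    · exact hfR c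
    · exact hgR d
  have hfun : ∀ s t t', E s t → E s t' → t = t' := by
    rintro s t t' (⟨c, hc, rfl, rfl⟩ | ⟨d, hd, rfl, rfl⟩) (⟨c', hc', h, rfl⟩ | ⟨d', hd', h, rfl⟩)
    · rw [Subtype.ext h]
    · exact absurd h.symm ((hC c).1 hc d' hd')
    · exact absurd h ((hC c').1 hc' d hd)
    · rw [hg h]
  have hinj : ∀ s s' t, E s t → E s' t → s = s' := by
    rintro s s' t (⟨c, hc, rfl, rfl⟩ | ⟨d, hd, rfl, rfl⟩) (⟨c', hc', rfl, h⟩ | ⟨d', hd', rfl, h⟩)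
    · rw [hf h]
    · exact absurd ⟨c, hc, h⟩ hd'
    · exact absurd ⟨c', hc', h.symm⟩ hd
    · rw [Subtype.ext h]
  have hAE : ∀ s ∈ A, ∃ t, E s t := by
    intro s hs
    by_cases hsC : (⟨s, hs⟩ : A) ∈ C
    · exact ⟨_, Or.inl ⟨_, hsC, rfl, rfl⟩⟩
    · rw [hC] at hsC
      push Not at hsC
      obtain ⟨d, hd, h⟩ := hsC
      exact ⟨_, Or.inr ⟨d, hd, h.symm, rfl⟩⟩
  have hBE : ∀ t ∈ B, ∃ s, E s t := by
    intro t ht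
    by_cases htC : t ∈ f '' C
    · obtain ⟨c, hc, rfl⟩ := htC
      exact ⟨_, Or.inl ⟨c, hc, rfl, rfl⟩⟩
    · exact ⟨_, Or.inr ⟨⟨t, ht⟩, htC, rfl, rfl⟩⟩
  choose e he using fun s : {s | ∃ t, E s t} => s.2
  refine ⟨{s | ∃ t, E s t}, {t | ∃ s, E s t}, fun s => ⟨e s, s, he s⟩, ⟨?_, ?_⟩, hAE, hBE,
    fun s => hER _ _ (he s)⟩
  · intro s s' h
    have h' : e s = e s' := congrArg Subtype.val h
    exact Subtype.ext (hinj _ _ _ (he s) (h' ▸ he s'))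
  · rintro ⟨t, s, hst⟩
    exact ⟨⟨s, t, hst⟩, Subtype.ext (hfun _ _ _ (he ⟨s, t, hst⟩) hst)⟩

/-- The summands of width greater than `ε` can be matched injectively along interleavings. -/
theorem exists_injective_of_interleaved {n a b ε : ℕ} (ha : 0 < a) {K : Type*} [Field K]
    {ι κ : Type*} [Finite κ]
    (lo hi : ι → Fin (n + 1)) (hIok : ∀ i, lo i ≤ hi i)
    (lo' hi' : κ → Fin (n + 1)) (hMok : ∀ j, lo' j ≤ hi' j)
    (hint : Interleaved (lamTrans n a b ε) (lamTrans n a b ε)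
        (Rep.dfsum fun i => intervalRep n K (lo i) (hi i))
        (Rep.dfsum fun j => intervalRep n K (lo' j) (hi' j))) :
    ∃ f : {s | ε < width n a b (lo s) (hi s)} → κ, Function.Injective f ∧
      ∀ s : {s | ε < width n a b (lo s) (hi s)},
        Interleaved (lamTrans n a b ε) (lamTrans n a b ε)
        (intervalRep n K (lo s) (hi s)) (intervalRep n K (lo' (f s)) (hi' (f s))) := by
  classical
  cases nonempty_fintype κ
  obtain ⟨φ, ψ, h⟩ := hint
  let x : ι → WithTop (Fin (n + 1)) := fun i => lo i
  let X : ι → WithTop (Fin (n + 1)) := fun i => hi i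
  let y : κ → WithTop (Fin (n + 1)) := fun j => lo' j
  let Y : κ → WithTop (Fin (n + 1)) := fun j => hi' j
  change RepHom (intervalSum K x X) ((intervalSum K y Y).shift (lamTrans n a b ε)) at φ
  change RepHom (intervalSum K y Y) ((intervalSum K x X).shift (lamTrans n a b ε)) at ψ
  let W := endWeight n a b
  let near : ι → κ → Prop := fun s t =>
    (a * lo' t ≤ a * lo s + ε ∧ W (hi' t) ≤ W (hi s) + ε) ∧
      (a * lo s ≤ a * lo' t + ε ∧ W (hi s) ≤ W (hi' t) + ε)
  let N : {s | ε < width n a b (lo s) (hi s)} → Finset κ := fun s =>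
    Finset.univ.filter fun t => near s t
  have hφ : ∀ s t, entry φ s t ≠ 0 →
      a * lo' t ≤ a * lo s + ε ∧ W (hi' t) ≤ W (hi s) + ε := fun s t hst =>
    (shiftLE_lamTrans_iff ha _ _ _ _).1 (shiftLE_of_entry_ne_zero φ hst)
  have hψ : ∀ t s, entry ψ t s ≠ 0 →
      a * lo s ≤ a * lo' t + ε ∧ W (hi s) ≤ W (hi' t) + ε := fun t s hst =>
    (shiftLE_lamTrans_iff ha _ _ _ _).1 (shiftLE_of_entry_ne_zero ψ hst)
  let α : {s | ε < width n a b (lo s) (hi s)} → ℕ := fun s => a * lo s + W (hi s)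
  have hout : ∀ A : Finset {s | ε < width n a b (lo s) (hi s)}, ∀ s ∈ A, ∀ s' ∈ A, α s ≤ α s' →
      ∑ t ∈ A.biUnion N, entry φ s t * entry ψ t s' = ∑ t, entry φ s t * entry ψ t s' := by
    intro A s hs s' hs' hα
    refine Finset.sum_subset (Finset.subset_univ _) fun t _ ht => ?_
    by_contra hne
    have h₁ := hφ s t (left_ne_zero_of_mul hne)
    have h₂ := hψ t s' (right_ne_zero_of_mul hne)
    have hns : ¬ near s t := fun hn =>
      ht (Finset.mem_biUnion.2 ⟨s, hs, Finset.mem_filter.2 ⟨Finset.mem_univ t, hn⟩⟩)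
    have hns' : ¬ near s' t := fun hn =>
      ht (Finset.mem_biUnion.2 ⟨s', hs', Finset.mem_filter.2 ⟨Finset.mem_univ t, hn⟩⟩)
    simp only [near] at hns hns'
    simp only [α] at hα
    omega
  have hhall : ∀ A : Finset {s | ε < width n a b (lo s) (hi s)},
      A.card ≤ (A.biUnion N).card := by
    intro A
    have hlarge : ∀ s : {s | ε < width n a b (lo s) (hi s)},
        lamFun n a b ε (lamFun n a b ε (lo s)) ≤ hi s := fun s => lamFun_lamFun_le_of_lt_width s.2
    have hMok' : ∀ j, y j ≤ Y j := fun j => WithTop.coe_le_coe.2 (hMok j)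
    have hIok' : ∀ i, x i ≤ X i := fun i => WithTop.coe_le_coe.2 (hIok i)
    refine card_le_card_of_sum_mul_eq A (A.biUnion N) (fun s t => entry φ s t)
      (fun t s => entry ψ t s) α (fun s hs => ?_) fun s hs s' hs' hne hα => ?_
    · rw [hout A s hs s hs le_rfl, sum_entry_mul_entry h hMok' (hIok' s), if_pos rfl]
      exact ⟨(lamFun_le n a b ε _).trans (lamFun_le n a b ε _), hlarge s⟩
    · rw [hout A s hs s' hs' hα]
      by_cases hmem : lamFun n a b ε (lamFun n a b ε (lo s)) ∈ Set.Icc (x s') (X s')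
      · rw [sum_entry_mul_entry h hMok' (hIok' s) hmem,
          if_neg fun h => hne (Subtype.ext h.symm)]
      · refine Finset.sum_eq_zero fun t _ => ?_
        by_contra hst
        have h₁ := shiftLE_of_entry_ne_zero φ (left_ne_zero_of_mul hst)
        have h₂ := shiftLE_of_entry_ne_zero ψ (right_ne_zero_of_mul hst)
        have hX : (hi s' : WithTop (Fin (n + 1))) < lamFun n a b ε (lamFun n a b ε (lo s)) := by
          by_contra! hX
          exact hmem ⟨h₂.1.trans (lamFun_mono n a b ε h₁.1), hX⟩
        have hW : W (hi s') ≤ W (hi s) :=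
          endWeight_mono n a b (WithTop.coe_le_coe.1 (hX.le.trans (hlarge s)))
        have hlo : lo s ≤ lo s' := by
          simp only [α] at hα
          exact Fin.le_def.2 (Nat.le_of_mul_le_mul_left (by omega) ha)
        refine hX.not_ge (le_trans ?_ (hlarge s'))
        exact lamFun_mono n a b ε (lamFun_mono n a b ε (WithTop.coe_le_coe.2 hlo))
  obtain ⟨f, hf, hfN⟩ := (Finset.all_card_le_biUnion_card_iff_exists_injective N).1 hhall
  refine ⟨f, hf, fun s => ?_⟩
  have hnear : near s (f s) := (Finset.mem_filter.1 (hfN s)).2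
  exact interleaved_of_shiftLE K ((shiftLE_lamTrans_iff ha _ _ _ _).2 hnear.1)
    ((shiftLE_lamTrans_iff ha _ _ _ _).2 hnear.2)

/-- Let `Λ_ε` be the maximal translation of height `ε` on
`P⁺ = {0, …, n} ∪ {∞}` and `I = ⊕ₛ Iₛ`, `M = ⊕ₜ Mₜ` finite direct sums of convex
representations of `{0, …, n}`.  If there is a `(Λ_ε, Λ_ε)`-interleaving between `I`
and `M`, then there is an `ε`-matching between `I` and `M`. -/
theorem statement18 (n a b ε : ℕ) (ha : 0 < a) (hb : 0 < b) {K : Type*} [Field K]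
    {ι κ : Type*} [Finite ι] [Finite κ]
    (lo hi : ι → Fin (n + 1)) (hIok : ∀ i, lo i ≤ hi i)
    (lo' hi' : κ → Fin (n + 1)) (hMok : ∀ j, lo' j ≤ hi' j)
    (hint : Interleaved (lamTrans n a b ε) (lamTrans n a b ε)
        (Rep.dfsum fun i => intervalRep n K (lo i) (hi i))
        (Rep.dfsum fun j => intervalRep n K (lo' j) (hi' j))) :
    IsMatching n a b ε K lo hi lo' hi' := by
  obtain ⟨f, hf, hfR⟩ := exists_injective_of_interleaved ha lo hi hIok lo' hi' hMok hint
  obtain ⟨g, hg, hgR⟩ := exists_injective_of_interleaved ha lo' hi' hMok lo hi hIok hint.symm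
  obtain ⟨S, T, e, he, hS, hT, hR⟩ := exists_bijective_of_injective
    (fun s t => Interleaved (lamTrans n a b ε) (lamTrans n a b ε)
      (intervalRep n K (lo s) (hi s)) (intervalRep n K (lo' t) (hi' t)))
    _ _ f hf hfR g hg fun t => (hgR t).symm
  exact ⟨S, T, e, he, fun _ hs => hS hs, fun _ ht => hT ht, hR⟩

end GPM
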